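/- Let k be an algebraically closed field and X a generating pattern on [n]. Suppose there exists σ ⊆ [n] such that: N(σ) = [n]; for every i ∈ σ, |N({i}) ∩ ([n] ∖ σ)| ≥ 1; and for every j ∈ [n] ∖ σ, |N({j}) ∩ σ| = 1. Then V_X = k^n. -/

import Mathlib

open scoped Classical

noncomputable section

/-- A *generating pattern* on `[n]`: a finite set `X` of nonempty subsets of `Fin n`
such that for all `i ≠ j` there is `σ ∈ X` with `i ∈ σ` and `j ∉ σ`. -/
def IsGenPattern (n : ℕ) (X : Finset (Finset (Fin n))) : Prop :=
  (∀ σ ∈ X, σ.Nonempty) ∧ ∀ i j : Fin n, i ≠ j → ∃ σ ∈ X, i ∈ σ ∧ j ∉ σ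

/-- Adjacency in the GCD graph of a generating pattern. -/
def GcdAdj {n : ℕ} (X : Finset (Finset (Fin n))) (i j : Fin n) : Prop :=
  i ≠ j ∧ ∃ σ ∈ X, i ∈ σ ∧ j ∈ σ

/-- The neighborhood of a set of vertices in the GCD graph. -/
def Nbhd {n : ℕ} (X : Finset (Finset (Fin n))) (S : Finset (Fin n)) : Finset (Fin n) :=
  Finset.univ.filter fun j => ∃ i ∈ S, GcdAdj X i j

/-- The differential edge `d_{σ,i}` (from `σ ∪ {i}` to `σ`) exists. -/
def DiffEdge {n : ℕ} (X : Finset (Finset (Fin n))) (σ : Finset (Fin n)) (i : Fin n) : Prop :=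
  i ∉ σ ∧ ∀ τ ∈ X, i ∈ τ → (τ ∩ σ).Nonempty

/-- The homotopy edge `h_{σ,i}` (from `σ` to `σ ∪ {i}`) exists. -/
def HomEdge {n : ℕ} (X : Finset (Finset (Fin n))) (σ : Finset (Fin n)) (i : Fin n) : Prop :=
  i ∉ σ ∧ i ∉ Nbhd X σ

/-- `sign(σ, i) = (-1)^{|{j ∈ σ : j < i}|}`. -/
def edgeSign {n : ℕ} (σ : Finset (Fin n)) (i : Fin n) : ℤ :=
  (-1) ^ (σ.filter fun j => j < i).card

/-- The Taylor matrix of the generating pattern `X`, evaluated at the point `a : Fin n → k`. -/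
def taylorMatrixAt {n : ℕ} {k : Type*} [Field k] (X : Finset (Finset (Fin n)))
    (a : Fin n → k) : Matrix (Finset (Fin n)) (Finset (Fin n)) k :=
  fun r c =>
    (∑ i : Fin n, if c = insert i r ∧ DiffEdge X r i then (edgeSign r i : k) else 0) +
      ∑ i : Fin n, if r = insert i c ∧ HomEdge X c i then (edgeSign c i : k) * a i else 0

/-- The cohomological support variety `V_X ⊆ k^n`: the locus where all
`2^(n-1) × 2^(n-1)` minors of the Taylor matrix vanish. -/
def supportVariety {n : ℕ} (k : Type*) [Field k] (X : Finset (Finset (Fin n))) :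
    Set (Fin n → k) :=
  { a | ∀ f g : Fin (2 ^ (n - 1)) → Finset (Fin n),
      Function.Injective f → Function.Injective g →
      ((taylorMatrixAt X a).submatrix f g).det = 0 }

lemma mem_Nbhd {n : ℕ} (X : Finset (Finset (Fin n))) (S : Finset (Fin n)) (j : Fin n) :
    j ∈ Nbhd X S ↔ ∃ i ∈ S, i ≠ j ∧ ∃ τ ∈ X, i ∈ τ ∧ j ∈ τ := by
  unfold Nbhd
  rw [Finset.mem_filter]
  simp [GcdAdj]

def tog {n : ℕ} (i : Fin n) (r : Finset (Fin n)) : Finset (Fin n) :=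
  if i ∈ r then r.erase i else insert i r

lemma mem_tog {n : ℕ} (i x : Fin n) (r : Finset (Fin n)) :
    x ∈ tog i r ↔ (x = i ∧ x ∉ r ∨ x ≠ i ∧ x ∈ r) := by
  unfold tog; split_ifs <;> simp <;> grind

lemma tog_comm {n : ℕ} (i j : Fin n) (r : Finset (Fin n)) :
    tog i (tog j r) = tog j (tog i r) := by
  ext x; simp only [mem_tog]; grind

lemma sign_tog {n : ℕ} {i j : Fin n} (hij : i ≠ j) (r : Finset (Fin n)) :
    edgeSign (tog i r) j = if i < j then - edgeSign r j else edgeSign r j := by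
  unfold edgeSign tog
  by_cases hi : i ∈ r <;> by_cases hlt : i < j <;> simp only [hi, hlt, if_true, if_false]
  · have h : i ∈ r.filter (fun x => x < j) := by simp [hi, hlt]
    rw [Finset.filter_erase, ← Finset.card_erase_add_one h, pow_succ]; ring
  · rw [Finset.filter_erase, Finset.erase_eq_of_notMem (by simp [hlt])]
  · rw [Finset.filter_insert, if_pos hlt, Finset.card_insert_of_notMem (by simp [hi]), pow_succ]
    ring
  · rw [Finset.filter_insert, if_neg hlt]

lemma sign_anti {n : ℕ} {i j : Fin n} (hij : i ≠ j) (r : Finset (Fin n)) :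
    edgeSign r i * edgeSign (tog i r) j = - (edgeSign r j * edgeSign (tog j r) i) := by
  rw [sign_tog hij, sign_tog hij.symm]
  rcases lt_or_gt_of_ne hij with h | h
  · simp [h, h.not_gt]; ring
  · simp [h, h.not_gt]; ring

lemma diff_diff {n : ℕ} (X : Finset (Finset (Fin n))) {i j : Fin n} (hij : i ≠ j)
    (r : Finset (Fin n)) (h : DiffEdge X r i ∧ DiffEdge X (insert i r) j) :
    DiffEdge X r j ∧ DiffEdge X (insert j r) i := by
  simp only [DiffEdge, Finset.Nonempty, Finset.mem_inter, Finset.mem_insert] at *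
  grind

lemma hom_hom {n : ℕ} (X : Finset (Finset (Fin n))) {i j : Fin n} (hij : i ≠ j)
    (r : Finset (Fin n)) (h : HomEdge X r i ∧ HomEdge X (insert i r) j) :
    HomEdge X r j ∧ HomEdge X (insert j r) i := by
  simp only [HomEdge, mem_Nbhd, Finset.mem_insert] at *
  grind

lemma diff_hom {n : ℕ} (X : Finset (Finset (Fin n))) {i j : Fin n} (hij : i ≠ j)
    (r : Finset (Fin n)) :
    (DiffEdge X (insert j r) i ∧ HomEdge X (insert i r) j) ↔
    (DiffEdge X r i ∧ HomEdge X r j) := by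
  simp only [HomEdge, DiffEdge, mem_Nbhd, Finset.Nonempty, Finset.mem_inter, Finset.mem_insert] at *
  constructor <;> grind

def cf {n : ℕ} {k : Type*} [Field k] (X : Finset (Finset (Fin n))) (a : Fin n → k)
    (r : Finset (Fin n)) (i : Fin n) : k :=
  if i ∈ r then (if HomEdge X (r.erase i) i then a i else 0)
  else (if DiffEdge X r i then 1 else 0)

lemma cf_mixed {n : ℕ} {k : Type*} [Field k] (X : Finset (Finset (Fin n))) (a : Fin n → k)
    {i j : Fin n} (hij : i ≠ j) (r : Finset (Fin n)) (hi : i ∉ r) (hj : j ∈ r) :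
    cf X a r i * cf X a (tog i r) j = cf X a r j * cf X a (tog j r) i := by
  have e := diff_hom X hij (r.erase j)
  rw [Finset.insert_erase hj, ← Finset.erase_insert_of_ne hij] at e
  simp only [cf, tog, hi, hj, hij, if_true, if_false, Finset.mem_insert, Finset.mem_erase,
    or_true, and_false]
  split_ifs <;> simp <;> tauto

lemma cf_comm {n : ℕ} {k : Type*} [Field k] (X : Finset (Finset (Fin n))) (a : Fin n → k)
    {i j : Fin n} (hij : i ≠ j) (r : Finset (Fin n)) :
    cf X a r i * cf X a (tog i r) j = cf X a r j * cf X a (tog j r) i := by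
  by_cases hi : i ∈ r <;> by_cases hj : j ∈ r
  · have e1 := hom_hom X hij ((r.erase i).erase j)
    have e2 := hom_hom X hij.symm ((r.erase i).erase j)
    have x1 : insert j ((r.erase i).erase j) = r.erase i :=
      Finset.insert_erase (by simp [hj, hij.symm])
    have x2 : insert i ((r.erase i).erase j) = r.erase j := by
      rw [Finset.erase_right_comm]
      exact Finset.insert_erase (by simp [hi, hij])
    rw [x1, x2] at e1 e2
    simp only [cf, tog, hi, hj, hij, hij.symm, if_true, Finset.mem_erase, ne_eq,
      not_false_eq_true, true_and]
    rw [Finset.erase_right_comm (a := j) (b := i)]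
    split_ifs <;> first | ring1 | (exfalso; simp_all; done)
  · exact (cf_mixed X a hij.symm r hj hi).symm
  · exact cf_mixed X a hij r hi hj
  · have e1 := diff_diff X hij r
    have e2 := diff_diff X hij.symm r
    simp only [cf, tog, hi, hj, hij, hij.symm, if_false, Finset.mem_insert, or_self]
    split_ifs <;> first | ring1 | (exfalso; simp_all; done)

lemma cf_diag {n : ℕ} {k : Type*} [Field k] (X : Finset (Finset (Fin n))) (a : Fin n → k)
    (hX : ∀ i : Fin n, ∃ τ ∈ X, i ∈ τ) (i : Fin n) (r : Finset (Fin n)) :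
    cf X a r i * cf X a (tog i r) i = 0 := by
  have key : ∀ s, ¬ (DiffEdge X s i ∧ HomEdge X s i) := by
    intro s
    obtain ⟨τ, hτ, hiτ⟩ := hX i
    simp only [HomEdge, DiffEdge, mem_Nbhd, Finset.Nonempty, Finset.mem_inter]
    grind
  by_cases hi : i ∈ r
  · have := key (r.erase i)
    simp only [cf, tog, hi, if_true, Finset.mem_erase, ne_eq, not_true_eq_false, false_and, if_false]
    split_ifs <;> first | (exfalso; tauto) | simp
  · have := key r
    simp only [cf, tog, hi, if_false, Finset.mem_insert, true_or, if_true,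
      Finset.erase_insert hi]
    split_ifs <;> first | (exfalso; tauto) | simp

lemma taylor_eq {n : ℕ} {k : Type*} [Field k] (X : Finset (Finset (Fin n))) (a : Fin n → k)
    (r c : Finset (Fin n)) : taylorMatrixAt X a r c =
      ∑ i, if c = tog i r then (edgeSign r i : k) * cf X a r i else 0 := by
  unfold taylorMatrixAt
  rw [← Finset.sum_add_distrib]
  refine Finset.sum_congr rfl fun i _ => ?_
  by_cases hi : i ∈ r
  · have h1 : ¬ DiffEdge X r i := fun h => h.1 hi
    simp only [h1, and_false, if_false, zero_add, cf, tog, hi, if_true]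
    by_cases hc : c = r.erase i
    · subst hc
      have : edgeSign (r.erase i) i = edgeSign r i := by
        unfold edgeSign
        rw [Finset.filter_erase, Finset.erase_eq_of_notMem (by simp)]
      simp [Finset.insert_erase hi, this]
    · rw [if_neg, if_neg hc]
      rintro ⟨rfl, h⟩
      exact hc (Finset.erase_insert h.1).symm
  · have h1 : ¬ (r = insert i c ∧ HomEdge X c i) := by
      rintro ⟨rfl, _⟩
      simp at hi
    simp only [h1, if_false, add_zero, cf, tog, hi]
    split_ifs <;> first | (exfalso; tauto) | simp

lemma taylor_mulVec {n : ℕ} {k : Type*} [Field k] (X : Finset (Finset (Fin n))) (a : Fin n → k)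
    (v : Finset (Fin n) → k) (r : Finset (Fin n)) :
    (taylorMatrixAt X a).mulVec v r =
      ∑ i, (edgeSign r i : k) * cf X a r i * v (tog i r) := by
  simp only [Matrix.mulVec, dotProduct, taylor_eq, Finset.sum_mul]
  rw [Finset.sum_comm]
  simp

lemma taylor_sq {n : ℕ} {k : Type*} [Field k] (X : Finset (Finset (Fin n))) (a : Fin n → k)
    (hX : ∀ i : Fin n, ∃ τ ∈ X, i ∈ τ) (v : Finset (Fin n) → k) :
    (taylorMatrixAt X a).mulVec ((taylorMatrixAt X a).mulVec v) = 0 := by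
  funext r
  simp only [taylor_mulVec, Finset.mul_sum, Pi.zero_apply]
  rw [← Finset.sum_product']
  refine Finset.sum_involution (fun p _ => (p.2, p.1)) ?_ ?_ (by simp) (by simp)
  · rintro ⟨i, j⟩ _
    by_cases hij : i = j
    · subst hij
      linear_combination (2 * (edgeSign r i : k) * edgeSign (tog i r) i * v (tog i (tog i r))) *
        cf_diag X a hX i r
    · have h1 : (edgeSign r i : k) * edgeSign (tog i r) j =
          - (edgeSign r j * edgeSign (tog j r) i) := by exact_mod_cast congrArg (Int.cast (R := k)) (sign_anti hij r)
      have h2 := cf_comm X a hij r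
      simp only
      rw [tog_comm i j]
      linear_combination (cf X a r i * cf X a (tog i r) j * v (tog j (tog i r))) * h1 -
        (edgeSign r j * edgeSign (tog j r) i * v (tog j (tog i r)) : k) * h2
  · rintro ⟨i, j⟩ _ hne heq
    apply hne
    obtain rfl : j = i := by simpa using congrArg Prod.fst heq
    linear_combination ((edgeSign r j : k) * edgeSign (tog j r) j * v (tog j (tog j r))) *
        cf_diag X a hX j r

/-- If `N(σ) = [n]`, every `i ∈ σ` has a neighbor outside `σ`, and every `j ∉ σ` has
exactly one neighbor in `σ`, then the support variety is everything. -/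
theorem isolated_in_degree_three (n : ℕ) (k : Type*) [Field k] [IsAlgClosed k]
    (X : Finset (Finset (Fin n))) (hX : IsGenPattern n X)
    (σ : Finset (Fin n))
    (h1 : Nbhd X σ = Finset.univ)
    (h2 : ∀ i ∈ σ, 1 ≤ ((Nbhd X {i}) \ σ).card)
    (h3 : ∀ j : Fin n, j ∉ σ → ((Nbhd X {j}) ∩ σ).card = 1) :
    supportVariety k X = Set.univ := by
  have hcov : ∀ i : Fin n, ∃ τ ∈ X, i ∈ τ := by
    intro i
    have : i ∈ Nbhd X σ := by simp [h1]
    rw [mem_Nbhd] at this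
    obtain ⟨_, _, _, τ, hτ, _, h⟩ := this
    exact ⟨τ, hτ, h⟩
  have huniq : ∀ j, j ∉ σ → ∃ i ∈ σ, ∀ x ∈ σ, (∃ τ ∈ X, x ∈ τ ∧ j ∈ τ) → x = i := by
    intro j hj
    obtain ⟨i, hi⟩ := Finset.card_eq_one.mp (h3 j hj)
    refine ⟨i, ?_, ?_⟩
    · have : i ∈ Nbhd X {j} ∩ σ := by simp [hi]
      exact (Finset.mem_inter.mp this).2
    · rintro x hx ⟨τ, hτ, h, h'⟩
      have : x ∈ Nbhd X {j} ∩ σ := by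
        rw [Finset.mem_inter, mem_Nbhd]
        exact ⟨⟨j, by simp, by rintro rfl; exact hj hx, τ, hτ, h', h⟩, hx⟩
      simpa [hi] using this
  have hD1 : ∀ j, ¬ DiffEdge X σ j := by
    rintro j ⟨hj, h⟩
    obtain ⟨i, hi, hu⟩ := huniq j hj
    obtain ⟨τ, hτ, hjτ, hiτ⟩ := hX.2 j i (by rintro rfl; exact hj hi)
    obtain ⟨x, hx⟩ := h τ hτ hjτ
    rw [Finset.mem_inter] at hx
    have := hu x hx.2 ⟨τ, hτ, hx.1, hjτ⟩
    subst this
    exact hiτ hx.1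
  have hD2 : ∀ i ∈ σ, ¬ DiffEdge X (σ.erase i) i := by
    rintro i hi ⟨_, h⟩
    obtain ⟨j, hj⟩ := Finset.card_pos.mp (h2 i hi)
    rw [Finset.mem_sdiff, mem_Nbhd] at hj
    obtain ⟨⟨i', hi', hne, τ, hτ, h4, h5⟩, hjσ⟩ := hj
    obtain rfl := Finset.mem_singleton.mp hi'
    obtain ⟨x, hx⟩ := h τ hτ h4
    rw [Finset.mem_inter, Finset.mem_erase] at hx
    obtain ⟨i0, hi0, hu⟩ := huniq j hjσ
    have e1 := hu x hx.2.2 ⟨τ, hτ, hx.1, h5⟩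
    have e2 := hu i' hi ⟨τ, hτ, h4, h5⟩
    exact hx.2.1 (e1.trans e2.symm)
  have hH1 : ∀ j, ¬ HomEdge X σ j := by
    rintro j ⟨_, h⟩
    simp [h1] at h
  have hH2 : ∀ i ∈ σ, ¬ HomEdge X (σ.erase i) i := by
    rintro i hi ⟨_, h⟩
    have : i ∈ Nbhd X σ := by simp [h1]
    rw [mem_Nbhd] at this h
    obtain ⟨x, hx, hne, ht⟩ := this
    exact h ⟨x, by simp [hx, hne], hne, ht⟩
  rw [Set.eq_univ_iff_forall]
  intro a f g hf hg
  by_contra hdet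
  have hcf1 : ∀ i, cf X a σ i = 0 := by
    intro i
    unfold cf
    by_cases hi : i ∈ σ
    · simp [hi, hH2 i hi]
    · simp [hi, hD1 i]
  have hcf2 : ∀ r i, σ = tog i r → cf X a r i = 0 := by
    rintro r i h
    unfold cf
    by_cases hi : i ∈ r
    · have : σ = r.erase i := by simpa [tog, hi] using h
      simp [hi, ← this, hH1]
    · have h' : σ = insert i r := by simpa [tog, hi] using h
      have h6 := hD2 i (by simp [h'])
      rw [h', Finset.erase_insert hi] at h6
      simp [hi, h6]
  set M := taylorMatrixAt X a with hM
  have hle : M.mulVecLin.range ≤ M.mulVecLin.ker := by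
    rintro _ ⟨v, rfl⟩
    simpa using taylor_sq X a hcov v
  have hlt : M.mulVecLin.range < M.mulVecLin.ker := by
    refine lt_of_le_of_ne hle fun heq => ?_
    have hmem : (Pi.single σ 1 : Finset (Fin n) → k) ∈ M.mulVecLin.ker := by
      rw [LinearMap.mem_ker, Matrix.mulVecLin_apply]
      funext r
      rw [hM, taylor_mulVec]
      refine Finset.sum_eq_zero fun i _ => ?_
      by_cases h : σ = tog i r
      · simp [hcf2 r i h]
      · simp [Pi.single_apply, Ne.symm h]
    rw [← heq] at hmem
    obtain ⟨v, hv⟩ := hmem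
    have := congrFun hv σ
    rw [Matrix.mulVecLin_apply, hM, taylor_mulVec] at this
    simp [hcf1] at this
  have hfin := Submodule.finrank_lt_finrank_of_lt hlt
  have hrn := LinearMap.finrank_range_add_finrank_ker M.mulVecLin
  have hcard : Module.finrank k (Finset (Fin n) → k) = 2 ^ n := by simp
  rw [hcard] at hrn
  have hrank : 2 ^ (n - 1) ≤ M.rank := by
    have h7 : (M.submatrix f g).rank = 2 ^ (n - 1) := by
      rw [Matrix.rank_of_isUnit _ ((Matrix.isUnit_iff_isUnit_det _).2 (isUnit_iff_ne_zero.2 hdet))]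
      simp
    rw [← h7]
    exact Matrix.rank_submatrix_le _ _ _
  unfold Matrix.rank at hrank
  have : 2 ^ n ≤ 2 * 2 ^ (n - 1) := by
    cases n with
    | zero => simp
    | succ m => simp [pow_succ, mul_comm]
  omega
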